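/- arXiv:1903.12350 — 8 statements merged into one kernel-verified Lean document; each statement's English description precedes it below -/
import Mathlib

section
/- Let P be a local (LHV) behavior in the 2-2-2 Bell scenario, i.e. P(a,b|x,y) = Σ_{λ∈Λ} q_λ · [a = f_λ x] · [b = g_λ y] for a finite index set Λ, weights q_λ ≥ 0 with Σ_λ q_λ = 1, and functions f_λ, g_λ : Fin 2 → Fin 2. If P(0,0|0,1) = 0, P(0,0|1,0) = 0 and P(1,1|1,1) = 0, then P(0,0|0,0) = 0. (The Hardy paradox conditions are inconsistent with any local hidden-variable theory.) -/
/-- A local model assigns probability zero to an event exactly when every hidden state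
producing that event has weight zero. -/
theorem sum_weight_mul_ite_eq_zero_iff {Λ α β : Type*} [Fintype Λ] [DecidableEq α]
    [DecidableEq β] {q : Λ → ℝ} (hq : ∀ l, 0 ≤ q l) (u : Λ → α) (v : Λ → β) (a : α) (b : β) :
    ∑ l, q l * (if a = u l then 1 else 0) * (if b = v l then 1 else 0) = 0 ↔
      ∀ l, a = u l → b = v l → q l = 0 := by
  rw [Finset.sum_eq_zero_iff_of_nonneg fun l _ =>
    mul_nonneg (mul_nonneg (hq l) (by split_ifs <;> simp)) (by split_ifs <;> simp)]
  simp only [Finset.mem_univ, true_imp_iff]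
  refine forall_congr' fun l => ?_
  split_ifs <;> simp_all

/-- The Hardy paradox conditions are inconsistent with any local hidden-variable
theory: if an LHV behavior `P` in the 2-2-2 Bell scenario satisfies
`P(0,0|0,1) = 0`, `P(0,0|1,0) = 0` and `P(1,1|1,1) = 0`, then `P(0,0|0,0) = 0`. -/
theorem hardy_no_LHV {Λ : Type*} [Fintype Λ]
    (q : Λ → ℝ) (f g : Λ → Fin 2 → Fin 2)
    (hq : ∀ l, 0 ≤ q l) (hqsum : ∑ l, q l = 1)
    (P : Fin 2 → Fin 2 → Fin 2 → Fin 2 → ℝ)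
    (hP : ∀ a b x y, P a b x y =
      ∑ l, q l * (if a = f l x then 1 else 0) * (if b = g l y then 1 else 0))
    (h1 : P 0 0 0 1 = 0) (h2 : P 0 0 1 0 = 0) (h3 : P 1 1 1 1 = 0) :
    P 0 0 0 0 = 0 := by
  rw [hP, sum_weight_mul_ite_eq_zero_iff hq] at h1 h2 h3 ⊢
  intro l hf hg
  by_cases hg1 : 0 = g l 1
  · exact h1 l hf hg1
  by_cases hf1 : 0 = f l 1
  · exact h2 l hf1 hg
  exact h3 l (by lia) (by lia)
end

section
/- Let P be a no-signaling behavior in the 2-2-2 Bell scenario satisfying the Hardy conditions P(0,0|0,1) = 0, P(0,0|1,0) = 0 and P(1,1|1,1) = 0. Then the exclusivity principle is saturated in the form P(1,0|0,1) + P(0,1|1,1) = 1 and P(0,1|1,0) + P(1,0|1,1) = 1. -/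
/-- For any no-signaling behavior in the 2-2-2 Bell scenario satisfying the Hardy
conditions `P(0,0|0,1) = 0`, `P(0,0|1,0) = 0`, `P(1,1|1,1) = 0`, the exclusivity
principle is saturated: `P(1,0|0,1) + P(0,1|1,1) = 1` and
`P(0,1|1,0) + P(1,0|1,1) = 1`. -/
theorem hardy_exclusivity_saturation
    (P : Fin 2 → Fin 2 → Fin 2 → Fin 2 → ℝ)
    (hpos : ∀ a b x y, 0 ≤ P a b x y)
    (hnorm : ∀ x y, ∑ a, ∑ b, P a b x y = 1)
    (hnsA : ∀ a x y y', ∑ b, P a b x y = ∑ b, P a b x y')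
    (hnsB : ∀ b y x x', ∑ a, P a b x y = ∑ a, P a b x' y)
    (h1 : P 0 0 0 1 = 0) (h2 : P 0 0 1 0 = 0) (h3 : P 1 1 1 1 = 0) :
    P 1 0 0 1 + P 0 1 1 1 = 1 ∧ P 0 1 1 0 + P 1 0 1 1 = 1 := by
  simp only [Fin.sum_univ_two] at hnorm hnsA hnsB
  constructor
  · linarith [hnorm 1 1, hnsB 0 1 0 1]
  · linarith [hnorm 1 1, hnsA 0 1 0 1]
end

section
/- Let P be a no-signaling behavior in the 2-2-2 Bell scenario with P(0,0|0,1) = 0, P(0,0|1,0) = 0 and P(1,1|1,1) = 0. Then the KCBS-type pentagon sum over the five Hardy events satisfies P(1,0|0,1) + P(0,1|1,1) + P(0,1|1,0) + P(1,0|1,1) + P(0,0|0,0) = 2 + P(0,0|0,0). In particular the pentagon sum exceeds 2 if and only if P(0,0|0,0) > 0. -/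
/-- For any no-signaling behavior in the 2-2-2 Bell scenario satisfying the Hardy
conditions, the KCBS-type pentagon sum over the five Hardy events equals
`2 + P(0,0|0,0)`; in particular it exceeds `2` iff `P(0,0|0,0) > 0`. -/
theorem hardy_pentagon_sum
    (P : Fin 2 → Fin 2 → Fin 2 → Fin 2 → ℝ)
    (hpos : ∀ a b x y, 0 ≤ P a b x y)
    (hnorm : ∀ x y, ∑ a, ∑ b, P a b x y = 1)
    (hnsA : ∀ a x y y', ∑ b, P a b x y = ∑ b, P a b x y')
    (hnsB : ∀ b y x x', ∑ a, P a b x y = ∑ a, P a b x' y)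
    (h1 : P 0 0 0 1 = 0) (h2 : P 0 0 1 0 = 0) (h3 : P 1 1 1 1 = 0) :
    P 1 0 0 1 + P 0 1 1 1 + P 0 1 1 0 + P 1 0 1 1 + P 0 0 0 0
      = 2 + P 0 0 0 0 ∧
    (2 < P 1 0 0 1 + P 0 1 1 1 + P 0 1 1 0 + P 1 0 1 1 + P 0 0 0 0
      ↔ 0 < P 0 0 0 0) := by
  have hsum : P 1 0 0 1 + P 0 1 1 1 + P 0 1 1 0 + P 1 0 1 1 = 2 := by
    have hA := hnsA 0 1 0 1
    have hB := hnsB 0 1 0 1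
    have hN := hnorm 1 1
    simp only [Fin.sum_univ_two] at hA hB hN
    linarith
  rw [hsum]
  exact ⟨rfl, lt_add_iff_pos_right 2⟩
end

section
/- Theorem 1 (classical impossibility of the CHSH paradox): Let P be a local (LHV) behavior in the 2-2-2 Bell scenario, i.e. a finite convex combination of local deterministic behaviors. If P(1,1|0,0) = 0, P(0,0|0,1) = 0, P(1,1|1,0) = 0 and P(0,1|1,1) = 0, then P(0,1|0,0) + P(0,1|1,0) = 0. Hence no non-contextual hidden-variable (local classical) theory can verify the CHSH paradox. -/
/-- Theorem 1: no local (non-contextual) hidden-variable theory can verify the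
CHSH paradox.  If an LHV behavior `P` in the 2-2-2 Bell scenario satisfies
`P(1,1|0,0) = 0`, `P(0,0|0,1) = 0`, `P(1,1|1,0) = 0` and `P(0,1|1,1) = 0`,
then `P(0,1|0,0) + P(0,1|1,0) = 0`. -/
theorem chsh_paradox_no_LHV {Λ : Type*} [Fintype Λ]
    (q : Λ → ℝ) (f g : Λ → Fin 2 → Fin 2)
    (hq : ∀ l, 0 ≤ q l) (hqsum : ∑ l, q l = 1)
    (P : Fin 2 → Fin 2 → Fin 2 → Fin 2 → ℝ)
    (hP : ∀ a b x y, P a b x y =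
      ∑ l, q l * (if a = f l x then 1 else 0) * (if b = g l y then 1 else 0))
    (h1 : P 1 1 0 0 = 0) (h2 : P 0 0 0 1 = 0)
    (h3 : P 1 1 1 0 = 0) (h4 : P 0 1 1 1 = 0) :
    P 0 1 0 0 + P 0 1 1 0 = 0 := by
  have vanish : ∀ a b x y, P a b x y = 0 → ∀ l, q l ≠ 0 → ¬(f l x = a ∧ g l y = b) := by
    rintro a b x y h l hl ⟨rfl, rfl⟩
    rw [hP, Finset.sum_eq_zero_iff_of_nonneg fun k _ => by have := hq k; positivity] at h
    exact hl (by simpa using h l (Finset.mem_univ l))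
  have g_zero : ∀ l, q l ≠ 0 → g l 0 ≠ 1 := by
    intro l hl
    have := vanish _ _ _ _ h1 l hl
    have := vanish _ _ _ _ h2 l hl
    have := vanish _ _ _ _ h3 l hl
    have := vanish _ _ _ _ h4 l hl
    grind
  have marginal : ∀ a x, P a 1 x 0 = 0 := by
    intro a x
    rw [hP]
    refine Finset.sum_eq_zero fun l _ => ?_
    by_cases hl : q l = 0
    · simp [hl]
    · simp [(g_zero l hl).symm]
  rw [marginal, marginal, add_zero]
end

section
/- Let P be a no-signaling behavior in the 2-2-2 Bell scenario satisfying P(1,1|0,0) = 0, P(0,0|0,1) = 0, P(1,1|1,0) = 0 and P(0,1|1,1) = 0. Then the exclusivity principle is saturated in the three forms: P(1,0|0,0) + P(0,1|0,1) = 1, P(1,0|0,1) + P(1,1|1,1) = 1, and P(1,0|1,0) + P(0,0|1,1) = 1. -/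
/-- For any no-signaling behavior in the 2-2-2 Bell scenario satisfying the CHSH
paradox zero conditions `P(1,1|0,0) = 0`, `P(0,0|0,1) = 0`, `P(1,1|1,0) = 0`,
`P(0,1|1,1) = 0`, the exclusivity principle is saturated in the three forms
`P(1,0|0,0) + P(0,1|0,1) = 1`, `P(1,0|0,1) + P(1,1|1,1) = 1` and
`P(1,0|1,0) + P(0,0|1,1) = 1`. -/
theorem chsh_exclusivity_saturation
    (P : Fin 2 → Fin 2 → Fin 2 → Fin 2 → ℝ)
    (hpos : ∀ a b x y, 0 ≤ P a b x y)
    (hnorm : ∀ x y, ∑ a, ∑ b, P a b x y = 1)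
    (hnsA : ∀ a x y y', ∑ b, P a b x y = ∑ b, P a b x y')
    (hnsB : ∀ b y x x', ∑ a, P a b x y = ∑ a, P a b x' y)
    (h1 : P 1 1 0 0 = 0) (h2 : P 0 0 0 1 = 0)
    (h3 : P 1 1 1 0 = 0) (h4 : P 0 1 1 1 = 0) :
    P 1 0 0 0 + P 0 1 0 1 = 1 ∧
    P 1 0 0 1 + P 1 1 1 1 = 1 ∧
    P 1 0 1 0 + P 0 0 1 1 = 1 := by
  simp only [Fin.sum_univ_two] at hnorm hnsA hnsB
  refine ⟨?_, ?_, ?_⟩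
  · linarith [hnorm 0 0, hnsA 0 0 0 1]
  · linarith [hnorm 1 1, hnsB 0 1 0 1]
  · linarith [hnorm 1 0, hnsA 0 1 0 1]
end

section
/- Let P be a no-signaling behavior in the 2-2-2 Bell scenario satisfying P(1,1|0,0) = 0, P(0,0|0,1) = 0, P(1,1|1,0) = 0 and P(0,1|1,1) = 0. Then the CHSH sum in probability form equals S_CHSH := P(0,1|0,0) + P(1,0|0,0) + P(0,1|0,1) + P(1,0|0,1) + P(1,1|1,1) + P(1,0|1,0) + P(0,0|1,1) + P(0,1|1,0) = 3 + P(0,1|0,0) + P(0,1|1,0). In particular, if moreover P(0,1|0,0) + P(0,1|1,0) > 0 (the CHSH paradox is verified), then S_CHSH > 3, i.e. the CHSH inequality in probability form is violated. -/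
/-- For any no-signaling behavior in the 2-2-2 Bell scenario satisfying the CHSH
paradox zero conditions, the CHSH sum in probability form equals
`3 + P(0,1|0,0) + P(0,1|1,0)`; in particular if `P(0,1|0,0) + P(0,1|1,0) > 0`
(the CHSH paradox is verified) then the CHSH inequality `S_CHSH ≤ 3` is violated. -/
theorem chsh_paradox_implies_violation
    (P : Fin 2 → Fin 2 → Fin 2 → Fin 2 → ℝ)
    (hpos : ∀ a b x y, 0 ≤ P a b x y)
    (hnorm : ∀ x y, ∑ a, ∑ b, P a b x y = 1)
    (hnsA : ∀ a x y y', ∑ b, P a b x y = ∑ b, P a b x y')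
    (hnsB : ∀ b y x x', ∑ a, P a b x y = ∑ a, P a b x' y)
    (h1 : P 1 1 0 0 = 0) (h2 : P 0 0 0 1 = 0)
    (h3 : P 1 1 1 0 = 0) (h4 : P 0 1 1 1 = 0) :
    P 0 1 0 0 + P 1 0 0 0 + P 0 1 0 1 + P 1 0 0 1 + P 1 1 1 1
        + P 1 0 1 0 + P 0 0 1 1 + P 0 1 1 0
      = 3 + P 0 1 0 0 + P 0 1 1 0 ∧
    (0 < P 0 1 0 0 + P 0 1 1 0 →
      3 < P 0 1 0 0 + P 1 0 0 0 + P 0 1 0 1 + P 1 0 0 1 + P 1 1 1 1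
        + P 1 0 1 0 + P 0 0 1 1 + P 0 1 1 0) := by
  simp only [Fin.sum_univ_two] at hnorm hnsA hnsB
  have key : P 0 1 0 0 + P 1 0 0 0 + P 0 1 0 1 + P 1 0 0 1 + P 1 1 1 1
      + P 1 0 1 0 + P 0 0 1 1 + P 0 1 1 0 = 3 + P 0 1 0 0 + P 0 1 1 0 := by
    linarith [hnorm 0 1, hnorm 1 1, hnsA 1 0 0 1, hnsA 1 1 0 1, hnsB 0 1 0 1]
  exact ⟨key, fun h => by linarith⟩
end

section
/- For every local (LHV) behavior P in the 2-2-2 Bell scenario, the CHSH sum in probability form satisfies P(0,1|0,0) + P(1,0|0,0) + P(0,1|0,1) + P(1,0|0,1) + P(1,1|1,1) + P(1,0|1,0) + P(0,0|1,1) + P(0,1|1,0) ≤ 3. -/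
/-- A local deterministic strategy, with outputs `a₀ a₁` and `b₀ b₁` for the two settings of each
party, satisfies at most three of the four CHSH conditions. -/
theorem chsh_deterministic_le_three (a₀ a₁ b₀ b₁ : Fin 2) :
    ((if 0 = a₀ then 1 else 0) * (if 1 = b₀ then 1 else 0)
      + (if 1 = a₀ then 1 else 0) * (if 0 = b₀ then 1 else 0)
      + (if 0 = a₀ then 1 else 0) * (if 1 = b₁ then 1 else 0)
      + (if 1 = a₀ then 1 else 0) * (if 0 = b₁ then 1 else 0)
      + (if 1 = a₁ then 1 else 0) * (if 1 = b₁ then 1 else 0)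
      + (if 1 = a₁ then 1 else 0) * (if 0 = b₀ then 1 else 0)
      + (if 0 = a₁ then 1 else 0) * (if 0 = b₁ then 1 else 0)
      + (if 0 = a₁ then 1 else 0) * (if 1 = b₀ then 1 else 0) : ℝ) ≤ 3 := by
  fin_cases a₀ <;> fin_cases a₁ <;> fin_cases b₀ <;> fin_cases b₁ <;> norm_num

/-- The CHSH inequality in probability form: every local (LHV) behavior in the
2-2-2 Bell scenario satisfies `S_CHSH ≤ 3`. -/
theorem chsh_probability_bound_LHV {Λ : Type*} [Fintype Λ]
    (q : Λ → ℝ) (f g : Λ → Fin 2 → Fin 2)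
    (hq : ∀ l, 0 ≤ q l) (hqsum : ∑ l, q l = 1)
    (P : Fin 2 → Fin 2 → Fin 2 → Fin 2 → ℝ)
    (hP : ∀ a b x y, P a b x y =
      ∑ l, q l * (if a = f l x then 1 else 0) * (if b = g l y then 1 else 0)) :
    P 0 1 0 0 + P 1 0 0 0 + P 0 1 0 1 + P 1 0 0 1 + P 1 1 1 1
        + P 1 0 1 0 + P 0 0 1 1 + P 0 1 1 0 ≤ 3 := by
  calc
    _ ≤ ∑ l, q l * 3 := by
      simp only [hP, mul_assoc, ← Finset.sum_add_distrib, ← mul_add]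
      gcongr with l
      · exact hq l
      · exact chsh_deterministic_le_three (f l 0) (f l 1) (g l 0) (g l 1)
    _ = 3 := by rw [← Finset.sum_mul, hqsum, one_mul]
end

section
/- Theorem 2 (no two-qubit state with local measurements verifies the CHSH paradox): Let ψ : Fin 2 × Fin 2 → ℂ with Σ_{i,j} |ψ(i,j)|² = 1 be a two-qubit state, and for x ∈ {0,1} let α_x : Fin 2 → ℂ and β_x : Fin 2 → ℂ be unit vectors, with outcome-0 eigenvector α_x (resp. β_y) and outcome-1 eigenvector a unit vector α_x^⊥ (resp. β_y^⊥) orthogonal to it. Define the local-measurement behavior P(a,b|x,y) = |Σ_{i,j} conj(u_a^x(i)) · conj(w_b^y(j)) · ψ(i,j)|², where u_0^x = α_x, u_1^x = α_x^⊥, w_0^y = β_y, w_1^y = β_y^⊥. If P(1,1|0,0) = 0, P(0,0|0,1) = 0, P(1,1|1,0) = 0 and P(0,1|1,1) = 0, then P(0,1|0,0) + P(0,1|1,0) = 0; thus no two-qubit state with local projective dichotomic measurements verifies the CHSH paradox. -/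
open Matrix in
/-- In a plane, a vector annihilated by two linearly independent functionals vanishes. -/
theorem eq_zero_of_dotProduct_eq_zero_of_det_ne_zero {K : Type*} [Field K] {u v x : Fin 2 → K}
    (hdet : u 0 * v 1 - u 1 * v 0 ≠ 0) (hu : u ⬝ᵥ x = 0) (hv : v ⬝ᵥ x = 0) : x = 0 := by
  simp only [dotProduct, Fin.sum_univ_two] at hu hv
  ext i
  refine (mul_eq_zero.mp ?_).resolve_left hdet
  fin_cases i <;> simp only [Fin.zero_eta, Fin.mk_one]
  · linear_combination v 1 * hu - u 1 * hv
  · linear_combination u 0 * hv - v 0 * hu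

open Matrix in
/-- Linearly dependent nonzero functionals on a plane have the same kernel. -/
theorem dotProduct_eq_zero_of_det_eq_zero {K : Type*} [Field K] {u v x : Fin 2 → K}
    (hdet : u 0 * v 1 - u 1 * v 0 = 0) (hv0 : v ≠ 0) (hv : v ⬝ᵥ x = 0) : u ⬝ᵥ x = 0 := by
  obtain ⟨i, hi⟩ := Function.ne_iff.mp hv0
  simp only [dotProduct, Fin.sum_univ_two] at hv ⊢
  refine (mul_eq_zero.mp ?_).resolve_left hi
  fin_cases i <;> simp only [Fin.zero_eta, Fin.mk_one]
  · linear_combination u 0 * hv - x 1 * hdet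
  · linear_combination u 1 * hv + x 0 * hdet

open Matrix in
theorem star_dotProduct_self_of_sum_normSq_eq_one {u : Fin 2 → ℂ}
    (hu : ∑ i, Complex.normSq (u i) = 1) : star u ⬝ᵥ u = 1 := by
  simp only [dotProduct, Pi.star_apply, RCLike.star_def, ← Complex.normSq_eq_conj_mul_self]
  exact_mod_cast hu

open Matrix in
/-- Orthonormal vectors of `ℂ²` are linearly independent. -/
theorem star_det_ne_zero_of_orthonormal {u v : Fin 2 → ℂ} (hu : star u ⬝ᵥ u = 1)
    (hv : star v ⬝ᵥ v = 1) (h : star u ⬝ᵥ v = 0) :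
    star u 0 * star v 1 - star u 1 * star v 0 ≠ 0 := by
  intro hdet
  have hu0 : star u ≠ 0 := by
    intro h0
    simp [h0] at hu
  have : star v ⬝ᵥ v = 0 :=
    dotProduct_eq_zero_of_det_eq_zero (by linear_combination -hdet) hu0 h
  exact one_ne_zero (hv.symm.trans this)

open Matrix in
/-- If a bilinear form on `ℂ²` satisfies the zero conditions of the CHSH paradox, then it
vanishes on the two pairs which the paradox requires to have positive probability. -/
theorem dotProduct_mulVec_eq_zero_of_chsh_zeros (M : Matrix (Fin 2) (Fin 2) ℂ)
    {a a' c c' b' d d' : Fin 2 → ℂ}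
    (ha : star a ⬝ᵥ a = 1) (ha' : star a' ⬝ᵥ a' = 1) (hc : star c ⬝ᵥ c = 1)
    (hc' : star c' ⬝ᵥ c' = 1) (hd : star d ⬝ᵥ d = 1) (hd' : star d' ⬝ᵥ d' = 1)
    (haa' : star a ⬝ᵥ a' = 0) (hcc' : star c ⬝ᵥ c' = 0) (hdd' : star d ⬝ᵥ d' = 0)
    (h1 : star a' ⬝ᵥ M *ᵥ star b' = 0) (h2 : star a ⬝ᵥ M *ᵥ star d = 0)
    (h3 : star c' ⬝ᵥ M *ᵥ star b' = 0) (h4 : star c ⬝ᵥ M *ᵥ star d' = 0) :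
    star a ⬝ᵥ M *ᵥ star b' = 0 ∧ star c ⬝ᵥ M *ᵥ star b' = 0 := by
  have ne {u : Fin 2 → ℂ} (hu : star u ⬝ᵥ u = 1) : u ≠ 0 := by
    rintro rfl
    simp at hu
  by_cases hdet : star a' 0 * star c' 1 - star a' 1 * star c' 0 = 0
  · have hac' : star a ⬝ᵥ c' = 0 := by
      rw [dotProduct_comm] at haa' ⊢
      refine dotProduct_eq_zero_of_det_eq_zero ?_ (ne ha') haa'
      have := congrArg star hdet
      simp only [Pi.star_apply, star_sub, star_mul', star_star, star_zero] at this
      linear_combination -this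
    have hdet' : star a 0 * star c 1 - star a 1 * star c 0 = 0 := by
      by_contra hne
      exact ne hc' (eq_zero_of_dotProduct_eq_zero_of_det_ne_zero hne hac' hcc')
    have had' := dotProduct_eq_zero_of_det_eq_zero hdet' (star_ne_zero.mpr (ne hc)) h4
    have ham : star a ᵥ* M = 0 := by
      refine eq_zero_of_dotProduct_eq_zero_of_det_ne_zero
        (star_det_ne_zero_of_orthonormal hd hd' hdd') ?_ ?_ <;>
      rwa [dotProduct_comm, ← dotProduct_mulVec]
    have hab : star a ⬝ᵥ M *ᵥ star b' = 0 := by rw [dotProduct_mulVec, ham, zero_dotProduct]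
    exact ⟨hab, dotProduct_eq_zero_of_det_eq_zero (by linear_combination -hdet')
      (star_ne_zero.mpr (ne ha)) hab⟩
  · rw [eq_zero_of_dotProduct_eq_zero_of_det_ne_zero hdet h1 h3]
    simp


/-- Theorem 2: no two-qubit state with local projective dichotomic measurements
verifies the CHSH paradox.  For a normalized two-qubit state `ψ` and local
measurements given on each side by a unit eigenvector for outcome `0` and an
orthogonal unit eigenvector for outcome `1`, the Born-rule behavior
`P(a,b|x,y)` cannot satisfy the zero conditions of the CHSH paradox together
with `P(0,1|0,0) + P(0,1|1,0) > 0`. -/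
theorem chsh_paradox_no_two_qubit_local
    (ψ : Fin 2 × Fin 2 → ℂ)
    (hψ : ∑ i, ∑ j, Complex.normSq (ψ (i, j)) = 1)
    (α αperp β βperp : Fin 2 → Fin 2 → ℂ)
    (hα : ∀ x, ∑ i, Complex.normSq (α x i) = 1)
    (hαperp : ∀ x, ∑ i, Complex.normSq (αperp x i) = 1)
    (hαorth : ∀ x, ∑ i, (starRingEnd ℂ) (α x i) * αperp x i = 0)
    (hβ : ∀ y, ∑ j, Complex.normSq (β y j) = 1)
    (hβperp : ∀ y, ∑ j, Complex.normSq (βperp y j) = 1)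
    (hβorth : ∀ y, ∑ j, (starRingEnd ℂ) (β y j) * βperp y j = 0)
    (P : Fin 2 → Fin 2 → Fin 2 → Fin 2 → ℝ)
    (hP : ∀ a b x y, P a b x y = Complex.normSq (∑ i, ∑ j,
      (starRingEnd ℂ) ((if a = 0 then α x else αperp x) i) *
      (starRingEnd ℂ) ((if b = 0 then β y else βperp y) j) * ψ (i, j)))
    (h1 : P 1 1 0 0 = 0) (h2 : P 0 0 0 1 = 0)
    (h3 : P 1 1 1 0 = 0) (h4 : P 0 1 1 1 = 0) :
    P 0 1 0 0 + P 0 1 1 0 = 0 := by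
  let M : Matrix (Fin 2) (Fin 2) ℂ := Matrix.of fun i j => ψ (i, j)
  have hPM : ∀ a b x y, P a b x y = 0 ↔
      star (if a = 0 then α x else αperp x) ⬝ᵥ
        M.mulVec (star (if b = 0 then β y else βperp y)) = 0 := by
    intro a b x y
    rw [hP, Complex.normSq_eq_zero]
    simp only [dotProduct, Matrix.mulVec, Finset.mul_sum, M, Matrix.of_apply, Pi.star_apply,
      RCLike.star_def, mul_assoc, mul_comm (ψ _)]
  rw [hPM] at h1 h2 h3 h4
  obtain ⟨h, h'⟩ := dotProduct_mulVec_eq_zero_of_chsh_zeros M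
    (star_dotProduct_self_of_sum_normSq_eq_one (hα 0))
    (star_dotProduct_self_of_sum_normSq_eq_one (hαperp 0))
    (star_dotProduct_self_of_sum_normSq_eq_one (hα 1))
    (star_dotProduct_self_of_sum_normSq_eq_one (hαperp 1))
    (star_dotProduct_self_of_sum_normSq_eq_one (hβ 1))
    (star_dotProduct_self_of_sum_normSq_eq_one (hβperp 1))
    (hαorth 0) (hαorth 1) (hβorth 1) h1 h2 h3 h4
  rw [(hPM 0 1 0 0).mpr h, (hPM 0 1 1 0).mpr h', add_zero]
end
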